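/- arXiv:2312.16666 — 2 statements merged into one kernel-verified Lean document; each statement's English description precedes it below -/
import Mathlib

section
/- Suppose W is finite with longest element w_S and J ⊆ S satisfies w_S·J·w_S = J. Then there exists an involution φ (a bijection with φ∘φ = id) of the set of core (I,J)-cosets (I ⊆ S varying) such that, for all core cosets p, q with right index J: p ≤_l q if and only if φ(q) ≤_l φ(p). -/
namespace CoxeterAtoms

variable {B : Type*} {W : Type*} [Group W] {M : CoxeterMatrix B}

/-- The standard parabolic subgroup `W_K` generated by the simple reflections indexed by `K`. -/
def par (cs : CoxeterSystem M W) (K : Set B) : Subgroup W :=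
  Subgroup.closure (cs.simple '' K)

/-- `K` is finitary if `W_K` is finite. -/
def Finitary (cs : CoxeterSystem M W) (K : Set B) : Prop :=
  ((par cs K : Set W)).Finite

/-- The left coset `W_I · x`. -/
def lcos (cs : CoxeterSystem M W) (I : Set B) (x : W) : Set W :=
  {w | ∃ a ∈ par cs I, w = a * x}

/-- The right coset `x · W_J`. -/
def rcos (cs : CoxeterSystem M W) (x : W) (J : Set B) : Set W :=
  {w | ∃ b ∈ par cs J, w = x * b}

/-- The double coset `W_I · x · W_J`. -/
def dcos (cs : CoxeterSystem M W) (I : Set B) (x : W) (J : Set B) : Set W :=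
  {w | ∃ a ∈ par cs I, ∃ b ∈ par cs J, w = a * x * b}

/-- `x` is a minimal length element of its double coset `W_I · x · W_J`. -/
def IsMinRep (cs : CoxeterSystem M W) (I : Set B) (x : W) (J : Set B) : Prop :=
  ∀ w ∈ dcos cs I x J, cs.length x ≤ cs.length w

/-- `y` is a maximal length element of the set `p`. -/
def IsMaxOf (cs : CoxeterSystem M W) (p : Set W) (y : W) : Prop :=
  y ∈ p ∧ ∀ w ∈ p, cs.length w ≤ cs.length y

/-- `y` is the longest element of the standard parabolic subgroup `W_K`. -/
def IsLongest (cs : CoxeterSystem M W) (K : Set B) (y : W) : Prop :=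
  y ∈ par cs K ∧ ∀ w ∈ par cs K, cs.length w ≤ cs.length y

/-- The double coset `W_I · x · W_J` is core: `W_I·x = W_I·x·W_J = x·W_J`. -/
def IsCore (cs : CoxeterSystem M W) (I : Set B) (x : W) (J : Set B) : Prop :=
  lcos cs I x = dcos cs I x J ∧ dcos cs I x J = rcos cs x J

/-- The left weak Bruhat order condition: `p ≤_l q`, where `p` is a core `(Ip,J)`-coset with
maximal element `pbar` and `q` a core coset (with the same right index `J`) with maximal
element `qbar`: there are a finitary `K` and `z : W` such that, with `r = W_K·z·W_{Ip}`,
one has `q̄ = r̄ · w_{Ip} · p̄` and `ℓ(q̄) = ℓ(r̄) − ℓ(w_{Ip}) + ℓ(p̄)`. -/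
def LeL (cs : CoxeterSystem M W) (Ip : Set B) (pbar qbar : W) : Prop :=
  ∃ wIp : W, IsLongest cs Ip wIp ∧
    ∃ K : Set B, Finitary cs K ∧ ∃ z rbar : W,
      IsMaxOf cs (dcos cs K z Ip) rbar ∧
      qbar = rbar * wIp * pbar ∧
      (cs.length qbar : ℤ) = (cs.length rbar : ℤ) - cs.length wIp + cs.length pbar

/-- The set of core `(I,J)`-cosets with fixed right index `J`, encoded as pairs
`(I, x)` where `x` is the minimal element of the coset `W_I·x·W_J`. -/
def CoreRight (cs : CoxeterSystem M W) (J : Set B) : Set (Set B × W) :=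
  {p | Finitary cs p.1 ∧ IsMinRep cs p.1 p.2 J ∧ IsCore cs p.1 p.2 J}

/-- The set of core `(I,M)`-cosets with fixed left index `I`, encoded as pairs
`(M, x)` where `x` is the minimal element of the coset `W_I·x·W_M`. -/
def CoreLeft (cs : CoxeterSystem M W) (I : Set B) : Set (Set B × W) :=
  {q | Finitary cs q.1 ∧ IsMinRep cs I q.2 q.1 ∧ IsCore cs I q.2 q.1}

/-- `p ≤_l q` for two core cosets with right index `J`, encoded as pairs. -/
def LeLPair (cs : CoxeterSystem M W) (J : Set B) (p q : Set B × W) : Prop :=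
  ∃ pbar qbar : W, IsMaxOf cs (dcos cs p.1 p.2 J) pbar ∧
    IsMaxOf cs (dcos cs q.1 q.2 J) qbar ∧ LeL cs p.1 pbar qbar

/-! ### Strong exchange via the action on signed group elements -/

open Classical in
/-- The action of a simple reflection on `W × ℤ/2`. -/
noncomputable def sgn (cs : CoxeterSystem M W) (i : B) : Function.End (W × ZMod 2) :=
  fun p => (cs.simple i * p.1 * cs.simple i, p.2 + if p.1 = cs.simple i then 1 else 0)

open Classical in
theorem sgn_pow (cs : CoxeterSystem M W) (i j : B) (n : ℕ) (t : W) (e : ZMod 2) :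
    ((sgn cs i * sgn cs j) ^ n) (t, e) =
      ((cs.simple i * cs.simple j) ^ n * t * ((cs.simple i * cs.simple j) ^ n)⁻¹,
        e + ∑ k ∈ Finset.range (2 * n),
          if t = cs.simple j * (cs.simple i * cs.simple j) ^ k then 1 else 0) := by
  induction n with
  | zero => simp; rfl
  | succ n ih =>
    rw [pow_succ']
    change sgn cs i (sgn cs j (((sgn cs i * sgn cs j) ^ n) (t, e))) = _
    rw [ih]
    set a := cs.simple i * cs.simple j with ha
    have hsi : cs.simple i * cs.simple i = 1 := cs.simple_mul_simple_self i
    have hsj : cs.simple j * cs.simple j = 1 := cs.simple_mul_simple_self j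
    have hai : a⁻¹ = cs.simple j * cs.simple i := by simp [ha]
    have hconj : ∀ k : ℕ, cs.simple j * a ^ k = (a ^ k)⁻¹ * cs.simple j := by
      intro k
      induction k with
      | zero => simp
      | succ k ihk =>
        have h0 : cs.simple j * a = a⁻¹ * cs.simple j := by rw [hai, ha]; simp [mul_assoc]
        calc cs.simple j * a ^ (k + 1) = cs.simple j * a ^ k * a := by rw [pow_succ, mul_assoc]
          _ = (a ^ k)⁻¹ * (cs.simple j * a) := by rw [ihk, mul_assoc]
          _ = (a ^ k)⁻¹ * a⁻¹ * cs.simple j := by rw [h0, mul_assoc]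
          _ = _ := by rw [← mul_inv_rev, ← pow_succ']
    have h1 : (a ^ n * t * (a ^ n)⁻¹ = cs.simple j) ↔ t = cs.simple j * a ^ (2 * n) := by
      rw [two_mul, pow_add, ← mul_assoc, hconj]
      constructor
      · intro h; rw [← h]; group
      · intro h; rw [h]; group
    have h2 : (cs.simple j * (a ^ n * t * (a ^ n)⁻¹) * cs.simple j = cs.simple i) ↔
        t = cs.simple j * a ^ (2 * n + 1) := by
      have e1 : cs.simple j * a ^ (2 * n + 1) =
          (a ^ n)⁻¹ * (cs.simple j * cs.simple i * cs.simple j) * a ^ n := by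
        rw [show 2 * n + 1 = n + 1 + n by ring, pow_add, ← mul_assoc, pow_succ, ← mul_assoc,
          hconj, ha]
        simp only [mul_assoc]
      rw [e1]
      constructor
      · intro h
        rw [← h]
        simp only [mul_assoc, cs.simple_mul_simple_cancel_left, hsj, mul_one]
        simp
      · intro h; rw [h]
        simp only [mul_assoc, cs.simple_mul_simple_cancel_left, hsj, mul_one]
        simp [hsj]
    rw [show 2 * (n + 1) = 2 * n + 1 + 1 by ring, Finset.sum_range_succ, Finset.sum_range_succ]
    simp only [sgn, h1, h2]
    refine Prod.ext ?_ ?_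
    · simp only [pow_succ', mul_inv_rev, hai]
      simp only [mul_assoc, ha]
    · simp only [add_assoc]

theorem sgn_liftable (cs : CoxeterSystem M W) : M.IsLiftable (sgn cs) := by
  classical
  intro i j
  funext ⟨t, e⟩
  rw [sgn_pow]
  have h : (cs.simple i * cs.simple j) ^ M i j = 1 := cs.simple_mul_simple_pow i j
  rw [h, two_mul, Finset.sum_range_add]
  simp only [pow_add, h, one_mul, CharTwo.add_self_eq_zero]
  simp
  rfl

/-- The action of `W` on `W × ℤ/2`. -/
noncomputable def rho (cs : CoxeterSystem M W) : W →* Function.End (W × ZMod 2) :=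
  cs.lift ⟨sgn cs, sgn_liftable cs⟩

theorem rho_simple (cs : CoxeterSystem M W) (i : B) : rho cs (cs.simple i) = sgn cs i :=
  cs.lift_apply_simple (sgn_liftable cs) i

open Classical in
theorem rho_word (cs : CoxeterSystem M W) (ω : List B) (t : W) (e : ZMod 2) :
    rho cs (cs.wordProd ω) (t, e) =
      (cs.wordProd ω * t * (cs.wordProd ω)⁻¹, e + ((cs.rightInvSeq ω).count t : ZMod 2)) := by
  induction ω with
  | nil => simp; rfl
  | cons i ω ih =>
    rw [cs.wordProd_cons, map_mul]
    change rho cs (cs.simple i) (rho cs (cs.wordProd ω) (t, e)) = _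
    rw [ih, rho_simple]
    simp only [sgn, CoxeterSystem.rightInvSeq, List.count_cons]
    have h : (cs.wordProd ω * t * (cs.wordProd ω)⁻¹ = cs.simple i) ↔
        ((cs.wordProd ω)⁻¹ * cs.simple i * cs.wordProd ω = t) := by
      constructor
      · intro h; rw [← h]; group
      · intro h; rw [← h]; group
    refine Prod.ext ?_ ?_
    · simp [mul_assoc]
    · simp only [h, beq_iff_eq]
      push_cast
      rw [add_assoc]

theorem rho_apply (cs : CoxeterSystem M W) (w t : W) :
    ∃ n : ZMod 2, ∀ e, rho cs w (t, e) = (w * t * w⁻¹, e + n) := by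
  classical
  obtain ⟨ω, rfl⟩ := cs.wordProd_surjective w
  exact ⟨_, fun e => rho_word cs ω t e⟩

theorem rho_refl (cs : CoxeterSystem M W) {t : W} (ht : cs.IsReflection t) (e : ZMod 2) :
    rho cs t (t, e) = (t, e + 1) := by
  obtain ⟨u, i, rfl⟩ := ht
  obtain ⟨n, hn⟩ := rho_apply cs u⁻¹ (u * cs.simple i * u⁻¹)
  obtain ⟨m, hm⟩ := rho_apply cs u (cs.simple i)
  have hnm : ∀ e : ZMod 2, e + n + m = e := by
    intro e
    have h1 : rho cs (u * u⁻¹) (u * cs.simple i * u⁻¹, e) = (u * cs.simple i * u⁻¹, e) := by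
      rw [mul_inv_cancel, map_one]; rfl
    rw [map_mul] at h1
    change rho cs u (rho cs u⁻¹ _) = _ at h1
    rw [hn] at h1
    have h2 : u⁻¹ * (u * cs.simple i * u⁻¹) * u⁻¹⁻¹ = cs.simple i := by group
    rw [h2, hm] at h1
    exact congrArg Prod.snd h1
  rw [map_mul, map_mul]
  change rho cs u (rho cs (cs.simple i) (rho cs u⁻¹ _)) = _
  have h2 : u⁻¹ * (u * cs.simple i * u⁻¹) * u⁻¹⁻¹ = cs.simple i := by group
  rw [hn, h2, rho_simple]
  have h3 : sgn cs i (cs.simple i, e + n) = (cs.simple i, e + n + 1) := by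
    simp [sgn]
  rw [h3, hm]
  refine Prod.ext rfl ?_
  have := hnm e
  change e + n + 1 + m = e + 1
  linear_combination this

/-- Strong exchange. -/
theorem strong_exchange (cs : CoxeterSystem M W) (ω : List B) {t : W} (ht : cs.IsReflection t)
    (hlt : cs.length (cs.wordProd ω * t) < cs.length (cs.wordProd ω)) :
    ∃ j < ω.length, cs.wordProd ω * t = cs.wordProd (ω.eraseIdx j) := by
  classical
  have hmem : t ∈ cs.rightInvSeq ω := by
    by_contra hnot
    obtain ⟨α, hα, hw⟩ := cs.exists_isReduced (cs.wordProd ω * t)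
    have h1 : rho cs (cs.wordProd ω * t) (t, 0) =
        (cs.wordProd ω * t * (cs.wordProd ω)⁻¹, 0 + 1 + ((0 : ℕ) : ZMod 2)) := by
      rw [map_mul]
      change rho cs (cs.wordProd ω) (rho cs t (t, 0)) = _
      rw [rho_refl cs ht, rho_word, List.count_eq_zero_of_not_mem hnot]
    rw [hw, rho_word] at h1
    have h2 := congrArg Prod.snd h1
    simp only [Nat.cast_zero, add_zero, zero_add] at h2
    have h3 : t ∈ cs.rightInvSeq α := by
      by_contra h
      rw [List.count_eq_zero_of_not_mem h] at h2
      simp at h2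
    have h4 := (cs.isRightInversion_of_mem_rightInvSeq hα h3).2
    rw [← hw, mul_assoc, ht.mul_self, mul_one] at h4
    omega
  obtain ⟨j, hj, hjt⟩ := List.mem_iff_getElem.mp hmem
  refine ⟨j, by simpa using hj, ?_⟩
  rw [← cs.wordProd_mul_getD_rightInvSeq, List.getD_eq_getElem _ 1 hj, hjt]

/-! ### Parabolic subgroups -/

theorem exists_kword (cs : CoxeterSystem M W) (K : Set B) {v : W} (hv : v ∈ par cs K) :
    ∃ ω : List B, (∀ i ∈ ω, i ∈ K) ∧ cs.wordProd ω = v := by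
  unfold par at hv
  induction hv using Subgroup.closure_induction with
  | mem x hx =>
    obtain ⟨i, hi, rfl⟩ := hx
    exact ⟨[i], by simpa using hi, by simp⟩
  | one => exact ⟨[], by simp, by simp⟩
  | mul x y _ _ hx hy =>
    obtain ⟨a, ha, rfl⟩ := hx
    obtain ⟨b, hb, rfl⟩ := hy
    refine ⟨a ++ b, ?_, cs.wordProd_append a b⟩
    intro i hi
    rcases List.mem_append.mp hi with h | h
    · exact ha i h
    · exact hb i h
  | inv x _ hx =>
    obtain ⟨a, ha, rfl⟩ := hx
    exact ⟨a.reverse, by simpa using ha, by simp⟩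

theorem kword_mem (cs : CoxeterSystem M W) (K : Set B) (ω : List B) (h : ∀ i ∈ ω, i ∈ K) :
    cs.wordProd ω ∈ par cs K := by
  induction ω with
  | nil => simpa using (par cs K).one_mem
  | cons i ω ih =>
    rw [cs.wordProd_cons]
    refine (par cs K).mul_mem (Subgroup.subset_closure ⟨i, h i (by simp), rfl⟩) (ih ?_)
    intro j hj
    exact h j (by simp [hj])

theorem max_word (cs : CoxeterSystem M W) (K : Set B) (y : W)
    (hy : ∀ v ∈ par cs K, cs.length (y * v) ≤ cs.length y) (ω : List B)
    (hK : ∀ i ∈ ω, i ∈ K)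
    (hmin : ∀ ω' : List B, (∀ i ∈ ω', i ∈ K) → cs.wordProd ω' = cs.wordProd ω →
      ω.length ≤ ω'.length) :
    cs.length (y * (cs.wordProd ω)⁻¹) + ω.length = cs.length y := by
  induction ω with
  | nil => simp
  | cons i ω ih =>
    have hKω : ∀ j ∈ ω, j ∈ K := fun j hj => hK j (by simp [hj])
    have hi : i ∈ K := hK i (by simp)
    have ih' := ih hKω (by
      intro ω' h1 h2
      have := hmin (i :: ω') (by
        intro j hj
        rcases List.mem_cons.mp hj with rfl | h
        · exact hi
        · exact h1 j h) (by rw [cs.wordProd_cons, cs.wordProd_cons, h2])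
      simpa using this)
    obtain ⟨β, hβ, hu⟩ := cs.exists_isReduced (y * (cs.wordProd ω)⁻¹)
    have hyw : cs.wordProd (β ++ ω) = y := by rw [cs.wordProd_append, ← hu]; group
    have hωm := kword_mem cs K ω hKω
    have him : cs.simple i ∈ par cs K := Subgroup.subset_closure ⟨i, hi, rfl⟩
    have ht : cs.IsReflection ((cs.wordProd ω)⁻¹ * cs.simple i * cs.wordProd ω) :=
      ⟨(cs.wordProd ω)⁻¹, i, by group⟩
    have htm : (cs.wordProd ω)⁻¹ * cs.simple i * cs.wordProd ω ∈ par cs K :=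
      (par cs K).mul_mem ((par cs K).mul_mem ((par cs K).inv_mem hωm) him) hωm
    have hlt := lt_of_le_of_ne (hy _ htm) (ht.length_mul_left_ne y)
    rw [← hyw] at hlt
    obtain ⟨j, hj, hje⟩ := strong_exchange cs (β ++ ω) ht hlt
    rw [cs.wordProd_cons, mul_inv_rev, cs.inv_simple, ← mul_assoc]
    by_cases hjβ : j < β.length
    · rw [List.eraseIdx_append_of_lt_length hjβ, cs.wordProd_append, cs.wordProd_append] at hje
      have h5 : y * (cs.wordProd ω)⁻¹ * cs.simple i = cs.wordProd (β.eraseIdx j) := by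
        rw [hu]
        have : cs.wordProd β * cs.simple i * cs.wordProd ω =
            cs.wordProd (β.eraseIdx j) * cs.wordProd ω := by
          rw [← hje]; group
        exact mul_right_cancel this
      have h6 : cs.length (y * (cs.wordProd ω)⁻¹ * cs.simple i) ≤ (β.eraseIdx j).length := by
        rw [h5]; exact cs.length_wordProd_le _
      have h7 := List.length_eraseIdx_add_one hjβ
      have h8 : cs.length (y * (cs.wordProd ω)⁻¹) = β.length := by rw [hu]; exact hβ
      have h9 := cs.length_mul_simple (y * (cs.wordProd ω)⁻¹) i
      simp only [List.length_cons]
      omega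
    · exfalso
      push Not at hjβ
      rw [List.eraseIdx_append_of_length_le hjβ, cs.wordProd_append, cs.wordProd_append] at hje
      have h5 : cs.wordProd (ω.eraseIdx (j - β.length)) = cs.wordProd (i :: ω) := by
        rw [cs.wordProd_cons]
        rw [mul_assoc] at hje
        rw [← mul_left_cancel hje]; group
      have h6 := hmin _ (fun k hk => hKω k (List.mem_of_mem_eraseIdx hk)) h5
      have h7 : j - β.length < ω.length := by simp at hj; omega
      have h8 := List.length_eraseIdx_add_one h7
      simp only [List.length_cons] at h6
      omega

/-- If `y` has maximal length in `y W_K` then `ℓ(y v) = ℓ(y) - ℓ(v)` for `v ∈ W_K`. -/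
theorem max_right (cs : CoxeterSystem M W) (K : Set B) (y : W)
    (hy : ∀ v ∈ par cs K, cs.length (y * v) ≤ cs.length y) {v : W} (hv : v ∈ par cs K) :
    cs.length (y * v) + cs.length v = cs.length y := by
  classical
  have hex : ∃ n : ℕ, ∃ ω : List B, (∀ i ∈ ω, i ∈ K) ∧ cs.wordProd ω = v⁻¹ ∧ ω.length = n := by
    obtain ⟨ω, h1, h2⟩ := exists_kword cs K ((par cs K).inv_mem hv)
    exact ⟨_, ω, h1, h2, rfl⟩
  obtain ⟨ω, h1, h2, h3⟩ := Nat.find_spec hex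
  have h4 := max_word cs K y hy ω h1 (by
    intro ω' h5 h6
    rw [h3]
    exact Nat.find_min' hex ⟨ω', h5, h6.trans h2, rfl⟩)
  rw [h2, inv_inv] at h4
  have h5 := cs.length_wordProd_le ω
  rw [h2, cs.length_inv] at h5
  have h6 := cs.length_le_length_mul_add_right y v
  omega

theorem max_left (cs : CoxeterSystem M W) (K : Set B) (y : W)
    (hy : ∀ v ∈ par cs K, cs.length (v * y) ≤ cs.length y) {v : W} (hv : v ∈ par cs K) :
    cs.length (v * y) + cs.length v = cs.length y := by
  have h := max_right cs K y⁻¹ (by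
    intro u hu
    have := hy u⁻¹ ((par cs K).inv_mem hu)
    rw [← cs.length_inv] at this
    simpa using this) ((par cs K).inv_mem hv)
  rw [← mul_inv_rev, cs.length_inv, cs.length_inv, cs.length_inv] at h
  exact h

theorem longest_unique (cs : CoxeterSystem M W) (K : Set B) {a b : W}
    (ha : IsLongest cs K a) (hb : IsLongest cs K b) : a = b := by
  have hm : a⁻¹ * b ∈ par cs K := (par cs K).mul_mem ((par cs K).inv_mem ha.1) hb.1
  have h := max_right cs K a (fun v hv => ha.2 _ ((par cs K).mul_mem ha.1 hv)) hm
  rw [mul_inv_cancel_left] at h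
  have h1 := hb.2 a ha.1
  have h2 : cs.length (a⁻¹ * b) = 0 := by omega
  rw [cs.length_eq_zero_iff] at h2
  exact (inv_mul_eq_one.mp h2)

theorem longest_sq (cs : CoxeterSystem M W) (K : Set B) {a : W}
    (ha : IsLongest cs K a) : a * a = 1 := by
  have h : IsLongest cs K a⁻¹ :=
    ⟨(par cs K).inv_mem ha.1, fun w hw => by rw [cs.length_inv]; exact ha.2 w hw⟩
  have := longest_unique cs K ha h
  nth_rw 2 [this]
  exact mul_inv_cancel a

theorem exists_longest (cs : CoxeterSystem M W) [Finite W] (K : Set B) :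
    ∃ a, IsLongest cs K a := by
  obtain ⟨a, ha, h⟩ := Set.exists_max_image (par cs K : Set W) cs.length (Set.toFinite _)
    ⟨1, (par cs K).one_mem⟩
  exact ⟨a, ha, h⟩

theorem core_max (cs : CoxeterSystem M W) (J : Set B) {wJ : W}
    (hwJ : IsLongest cs J wJ) {p : Set B × W} (hp : p ∈ CoreRight cs J) {y : W}
    (hy : IsMaxOf cs (dcos cs p.1 p.2 J) y) :
    y = p.2 * wJ ∧ cs.length y = cs.length p.2 + cs.length wJ := by
  obtain ⟨_, hmin, _, hcore⟩ := hp
  have hsub : ∀ v ∈ par cs J, y * v ∈ dcos cs p.1 p.2 J := by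
    intro v hv
    obtain ⟨a, ha, b, hb, h⟩ := hy.1
    exact ⟨a, ha, b * v, (par cs J).mul_mem hb hv, by rw [h]; group⟩
  have hmax : ∀ v ∈ par cs J, cs.length (y * v) ≤ cs.length y := fun v hv => hy.2 _ (hsub v hv)
  have hy1 := hy.1
  rw [hcore] at hy1
  obtain ⟨b, hb, rfl⟩ := hy1
  have h1 := max_right cs J _ hmax ((par cs J).inv_mem hb)
  have h2 := max_right cs J _ hmax hwJ.1
  have h3 := hmin _ (hsub wJ hwJ.1)
  rw [mul_inv_cancel_right, cs.length_inv] at h1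
  have hbl : IsLongest cs J b := ⟨hb, fun w hw => by have := hwJ.2 w hw; omega⟩
  have hbe := longest_unique cs J hbl hwJ
  subst hbe
  exact ⟨rfl, h1.symm⟩

theorem core_isMax (cs : CoxeterSystem M W) [Finite W] (J : Set B) {wJ : W}
    (hwJ : IsLongest cs J wJ) {p : Set B × W} (hp : p ∈ CoreRight cs J) :
    IsMaxOf cs (dcos cs p.1 p.2 J) (p.2 * wJ) := by
  obtain ⟨a, ha, h⟩ := Set.exists_max_image (dcos cs p.1 p.2 J) cs.length (Set.toFinite _)
    ⟨p.2, 1, one_mem _, 1, one_mem _, by simp⟩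
  have h2 : IsMaxOf cs (dcos cs p.1 p.2 J) a := ⟨ha, h⟩
  rw [← (core_max cs J hwJ hp h2).1]
  exact h2

theorem leLPair_iff (cs : CoxeterSystem M W) [Finite W] (J : Set B) {p q : Set B × W}
    (hp : p ∈ CoreRight cs J) (hq : q ∈ CoreRight cs J) :
    LeLPair cs J p q ↔ ∃ a : W, q.2 = a * p.2 ∧
      cs.length q.2 = cs.length a + cs.length p.2 := by
  obtain ⟨wJ, hwJ⟩ := exists_longest cs J
  constructor
  · rintro ⟨pb, qb, hpb, hqb, wI, hwI, K, -, z, r, hr, he, hl⟩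
    obtain ⟨hp1, hp2⟩ := core_max cs J hwJ hp hpb
    obtain ⟨hq1, hq2⟩ := core_max cs J hwJ hq hqb
    have h := max_right cs p.1 r (by
      intro v hv
      apply hr.2
      obtain ⟨a, ha, b, hb, h⟩ := hr.1
      exact ⟨a, ha, b * v, (par cs p.1).mul_mem hb hv, by rw [h]; group⟩) hwI.1
    refine ⟨r * wI, ?_, by omega⟩
    rw [hp1, hq1, ← mul_assoc] at he
    exact mul_right_cancel he
  · rintro ⟨a, ha, hl⟩
    obtain ⟨wI, hwI⟩ := exists_longest cs p.1
    have hpb := core_isMax cs J hwJ hp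
    have hqb := core_isMax cs J hwJ hq
    have hp2 := (core_max cs J hwJ hp hpb).2
    have hq2 := (core_max cs J hwJ hq hqb).2
    have hsq := longest_sq cs _ hwI
    have h1 := max_left cs p.1 (p.2 * wJ) (by
      intro v hv
      apply hpb.2
      obtain ⟨a, ha, b, hb, h⟩ := hpb.1
      exact ⟨v * a, (par cs p.1).mul_mem hv ha, b, hb, by rw [h]; group⟩) hwI.1
    have he : q.2 * wJ = a * wI * wI * (p.2 * wJ) := by
      rw [mul_assoc a, hsq, mul_one, ha, mul_assoc]
    have h2 := cs.length_mul_le (a * wI) (wI * (p.2 * wJ))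
    rw [← mul_assoc, ← he] at h2
    have h3 := cs.length_mul_le a wI
    refine ⟨_, _, hpb, hqb, wI, hwI, ∅, Set.toFinite _, a, a * wI, ⟨?_, ?_⟩, he, by omega⟩
    · exact ⟨1, one_mem _, wI, hwI.1, by simp⟩
    · rintro w ⟨c, hc, b, hb, rfl⟩
      have hc1 : c = 1 := by simpa [par] using hc
      subst hc1
      rw [one_mul]
      have h4 := cs.length_mul_le a b
      have h5 := hwI.2 b hb
      omega

theorem statement_13 (cs : CoxeterSystem M W) [Finite W] (wS : W)
    (hwS : ∀ w : W, cs.length w ≤ cs.length wS)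
    (J : Set B)
    (hJ : (fun v => wS * v * wS) '' (cs.simple '' J) = cs.simple '' J) :
    ∃ φ : Set B × W → Set B × W,
      Set.BijOn φ (CoreRight cs J) (CoreRight cs J) ∧
      (∀ p ∈ CoreRight cs J, φ (φ p) = p) ∧
      ∀ p ∈ CoreRight cs J, ∀ q ∈ CoreRight cs J,
        (LeLPair cs J p q ↔ LeLPair cs J (φ q) (φ p)) := by
  have huniv : ∀ v : W, v ∈ par cs Set.univ := by
    intro v
    simp [par, Set.image_univ, cs.subgroup_closure_range_simple]
  have hSr : ∀ v : W, cs.length (v * wS) + cs.length v = cs.length wS := fun v =>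
    max_left cs Set.univ wS (fun u _ => hwS _) (huniv v)
  have hSS : wS * wS = 1 := longest_sq cs Set.univ ⟨huniv _, fun w _ => hwS w⟩
  have hSl : ∀ v : W, cs.length (wS * v) + cs.length v = cs.length wS := fun v =>
    max_right cs Set.univ wS (fun u _ => hwS _) (huniv v)
  have hSinv : wS⁻¹ = wS := inv_eq_of_mul_eq_one_right hSS
  have hpar : ∀ v ∈ par cs J, wS * v * wS ∈ par cs J := by
    intro v hv
    have h : (par cs J).map (MulAut.conj wS).toMonoidHom = par cs J := by
      unfold par
      rw [MonoidHom.map_closure]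
      congr 1
      conv_rhs => rw [← hJ]
      apply Set.image_congr
      intro a _
      simp [hSinv]
    rw [← h]
    exact ⟨v, hv, by simp [hSinv]⟩
  obtain ⟨wJ, hwJ⟩ := exists_longest cs J
  have hJJ := longest_sq cs J hwJ
  have hcJ : wS * wJ * wS = wJ := by
    refine longest_unique cs J ⟨hpar _ hwJ.1, fun w hw => ?_⟩ hwJ
    have h1 := hSr (wS * wJ)
    have h2 := hSl wJ
    have h3 := hwJ.2 w hw
    omega
  have hφφ : ∀ x : W, x * wJ * wS * wJ * wS = x := by
    intro x
    calc x * wJ * wS * wJ * wS = x * wJ * (wS * wJ * wS) := by group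
      _ = x := by rw [hcJ, mul_assoc, hJJ, mul_one]
  have hmaps : ∀ p ∈ CoreRight cs J, ((p.1, p.2 * wJ * wS) : Set B × W) ∈ CoreRight cs J := by
    intro p hp
    have hmx := core_isMax cs J hwJ hp
    obtain ⟨h1, h2, h3, h4⟩ := hp
    have hd : ∀ w, w ∈ dcos cs p.1 (p.2 * wJ * wS) J ↔ w * wS ∈ dcos cs p.1 p.2 J := by
      intro w
      constructor
      · rintro ⟨a, ha, b, hb, rfl⟩
        exact ⟨a, ha, wJ * (wS * b * wS), mul_mem hwJ.1 (hpar b hb), by group⟩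
      · rintro ⟨a, ha, b, hb, h⟩
        refine ⟨a, ha, wS * (wJ * b) * wS, hpar _ (mul_mem hwJ.1 hb), ?_⟩
        calc w = w * wS * wS := by rw [mul_assoc, hSS, mul_one]
          _ = a * p.2 * 1 * b * wS := by rw [h]; group
          _ = a * p.2 * (wJ * 1 * wJ) * b * wS := by rw [mul_one wJ, hJJ]
          _ = a * p.2 * (wJ * (wS * wS) * wJ) * b * wS := by rw [hSS]
          _ = _ := by group
    have hr : ∀ w, w ∈ rcos cs (p.2 * wJ * wS) J ↔ w * wS ∈ rcos cs p.2 J := by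
      intro w
      constructor
      · rintro ⟨b, hb, rfl⟩
        exact ⟨wJ * (wS * b * wS), mul_mem hwJ.1 (hpar b hb), by group⟩
      · rintro ⟨b, hb, h⟩
        refine ⟨wS * (wJ * b) * wS, hpar _ (mul_mem hwJ.1 hb), ?_⟩
        calc w = w * wS * wS := by rw [mul_assoc, hSS, mul_one]
          _ = p.2 * 1 * b * wS := by rw [h]; group
          _ = p.2 * (wJ * 1 * wJ) * b * wS := by rw [mul_one wJ, hJJ]
          _ = p.2 * (wJ * (wS * wS) * wJ) * b * wS := by rw [hSS]
          _ = _ := by group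
    have hxl := hmx.1
    rw [← h3] at hxl
    obtain ⟨c, hc, hce⟩ := hxl
    have hl : ∀ w, w ∈ lcos cs p.1 (p.2 * wJ * wS) ↔ w * wS ∈ lcos cs p.1 p.2 := by
      intro w
      rw [hce]
      constructor
      · rintro ⟨a, ha, rfl⟩
        refine ⟨a * c, mul_mem ha hc, ?_⟩
        calc _ = a * c * p.2 * (wS * wS) := by group
          _ = _ := by rw [hSS, mul_one]
      · rintro ⟨a, ha, h⟩
        refine ⟨a * c⁻¹, mul_mem ha (inv_mem hc), ?_⟩
        calc w = w * wS * wS := by rw [mul_assoc, hSS, mul_one]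
          _ = _ := by rw [h]; group
    refine ⟨h1, ?_, ?_, ?_⟩
    · intro w hw
      have h5 := hmx.2 _ ((hd w).1 hw)
      have h6 := hSr w
      have h7 := hSr (p.2 * wJ)
      simp only
      omega
    · ext w
      simp only
      rw [hl, hd, h3]
    · ext w
      simp only
      rw [hr, hd, h4]
  refine ⟨fun p => (p.1, p.2 * wJ * wS), ?_, ?_, ?_⟩
  · have hinv : ∀ p ∈ CoreRight cs J, (fun p : Set B × W => (p.1, p.2 * wJ * wS))
        ((fun p : Set B × W => (p.1, p.2 * wJ * wS)) p) = p := by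
      intro p _
      exact Prod.ext rfl (hφφ p.2)
    exact Set.InvOn.bijOn (f' := fun p : Set B × W => (p.1, p.2 * wJ * wS))
      ⟨hinv, hinv⟩ hmaps hmaps
  · intro p _
    exact Prod.ext rfl (hφφ p.2)
  · intro p hp q hq
    rw [leLPair_iff cs J hp hq, leLPair_iff cs J (hmaps q hq) (hmaps p hp)]
    have hp2 := (core_max cs J hwJ hp (core_isMax cs J hwJ hp)).2
    have hq2 := (core_max cs J hwJ hq (core_isMax cs J hwJ hq)).2
    have hp3 := hSr (p.2 * wJ)
    have hq3 := hSr (q.2 * wJ)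
    simp only
    constructor
    · rintro ⟨a, h1, h2⟩
      refine ⟨a⁻¹, by rw [h1]; group, ?_⟩
      rw [cs.length_inv]
      omega
    · rintro ⟨a, h1, h2⟩
      refine ⟨a⁻¹, ?_, ?_⟩
      · simp only [← mul_assoc] at h1
        rw [mul_right_cancel (mul_right_cancel h1), inv_mul_cancel_left]
      · rw [cs.length_inv]
        omega

end CoxeterAtoms
end

section
/- Let I, J ⊆ S be finitary and let p be an (I,J)-coset with minimal element p̲. Then p is core (i.e. W_I·p̲ = W_I·p̲·W_J = p̲·W_J) if and only if I = p̲·J·p̲⁻¹, where p̲·J·p̲⁻¹ denotes the set {p̲·u·p̲⁻¹ : u ∈ J}. -/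
namespace CoxeterAtoms

variable {B : Type*} {W : Type*} [Group W] {M : CoxeterMatrix B}

open Classical in
/-- Signed permutation attached to a simple reflection. -/
noncomputable def sig (cs : CoxeterSystem M W) (i : B) : Equiv.Perm (W × ZMod 2) where
  toFun q := (cs.simple i * q.1 * cs.simple i, q.2 + if q.1 = cs.simple i then 1 else 0)
  invFun q := (cs.simple i * q.1 * cs.simple i, q.2 + if q.1 = cs.simple i then 1 else 0)
  left_inv := by
    rintro ⟨t, e⟩
    have h : cs.simple i * t * cs.simple i = cs.simple i ↔ t = cs.simple i := by
      constructor
      · intro h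
        have h2 := congrArg (fun z => cs.simple i * z * cs.simple i) h
        simpa [mul_assoc] using h2
      · rintro rfl; simp
    simp only [h, Prod.mk.injEq]
    refine ⟨by simp [mul_assoc], ?_⟩
    split_ifs
    · rw [add_assoc, CharTwo.add_self_eq_zero, add_zero]
    · simp
  right_inv := by
    rintro ⟨t, e⟩
    have h : cs.simple i * t * cs.simple i = cs.simple i ↔ t = cs.simple i := by
      constructor
      · intro h
        have h2 := congrArg (fun z => cs.simple i * z * cs.simple i) h
        simpa [mul_assoc] using h2
      · rintro rfl; simp
    simp only [h, Prod.mk.injEq]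
    refine ⟨by simp [mul_assoc], ?_⟩
    split_ifs
    · rw [add_assoc, CharTwo.add_self_eq_zero, add_zero]
    · simp

open Classical in
theorem sig_apply (cs : CoxeterSystem M W) (i : B) (t : W) (e : ZMod 2) :
    sig cs i (t, e) = (cs.simple i * t * cs.simple i, e + if t = cs.simple i then 1 else 0) := rfl

theorem pow_conj_simple (cs : CoxeterSystem M W) (i j : B) (n : ℕ) :
    ((cs.simple i * cs.simple j) ^ n)⁻¹ * cs.simple j =
      cs.simple j * (cs.simple i * cs.simple j) ^ n := by
  induction n with
  | zero => simp
  | succ n ih =>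
    rw [pow_succ', mul_inv_rev, mul_assoc, mul_inv_rev, cs.inv_simple, cs.inv_simple,
      ← pow_succ', pow_succ, ← mul_assoc (cs.simple j), ← ih]
    simp only [mul_assoc]

open Classical in
theorem sig_pow (cs : CoxeterSystem M W) (i j : B) (n : ℕ) (t : W) (e : ZMod 2) :
    ((sig cs i * sig cs j) ^ n) (t, e) =
      ((cs.simple i * cs.simple j) ^ n * t * ((cs.simple i * cs.simple j) ^ n)⁻¹,
        e + ∑ k ∈ Finset.range (2 * n),
          if t = cs.simple j * (cs.simple i * cs.simple j) ^ k then 1 else 0) := by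
  induction n with
  | zero => simp
  | succ n ih =>
    rw [pow_succ', Equiv.Perm.mul_apply, ih, Equiv.Perm.mul_apply, sig_apply, sig_apply]
    set x := cs.simple i * cs.simple j with hx
    have hc := pow_conj_simple cs i j n
    rw [← hx] at hc
    have e1 : (x ^ n * t * (x ^ n)⁻¹ = cs.simple j) ↔ t = cs.simple j * x ^ (2 * n) := by
      rw [two_mul, pow_add, ← mul_assoc, ← hc, mul_inv_eq_iff_eq_mul, ← eq_inv_mul_iff_mul_eq,
        mul_assoc]
    have e2 : (cs.simple j * (x ^ n * t * (x ^ n)⁻¹) * cs.simple j = cs.simple i) ↔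
        t = cs.simple j * x ^ (2 * n + 1) := by
      have h3 : cs.simple j * x ^ (2 * n + 1) =
          (x ^ n)⁻¹ * (cs.simple j * cs.simple i * cs.simple j) * x ^ n := by
        rw [show 2 * n + 1 = n + 1 + n by ring, pow_add, ← mul_assoc, pow_succ, ← mul_assoc,
          ← hc, hx]
        simp only [mul_assoc]
      rw [h3]
      constructor
      · intro h
        rw [← h]
        simp [mul_assoc]
      · rintro rfl
        simp [mul_assoc]
    rw [show 2 * (n + 1) = 2 * n + 1 + 1 by ring, Finset.sum_range_succ, Finset.sum_range_succ]
    simp only [e1, e2, Prod.mk.injEq]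
    refine ⟨?_, by ring⟩
    rw [pow_succ', mul_inv_rev, hx, mul_inv_rev, cs.inv_simple, cs.inv_simple]
    simp only [mul_assoc]

theorem sig_liftable (cs : CoxeterSystem M W) : M.IsLiftable (sig cs) := by
  classical
  intro i j
  ext1 ⟨t, e⟩
  rw [sig_pow, two_mul, Finset.sum_range_add]
  simp only [pow_add, cs.simple_mul_simple_pow, one_mul]
  rw [CharTwo.add_self_eq_zero]
  simp

/-- The lifted action on signed elements. -/
noncomputable def act (cs : CoxeterSystem M W) : W →* Equiv.Perm (W × ZMod 2) :=
  cs.lift ⟨sig cs, sig_liftable cs⟩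

theorem act_simple (cs : CoxeterSystem M W) (i : B) : act cs (cs.simple i) = sig cs i :=
  cs.lift_apply_simple (sig_liftable cs) i

open Classical in
theorem act_word (cs : CoxeterSystem M W) (ω : List B) (t : W) (e : ZMod 2) :
    act cs (cs.wordProd ω) (t, e) =
      (cs.wordProd ω * t * (cs.wordProd ω)⁻¹, e + ((cs.rightInvSeq ω).count t : ℕ)) := by
  induction ω with
  | nil => simp
  | cons i ω ih =>
    rw [cs.wordProd_cons, map_mul, Equiv.Perm.mul_apply, ih, act_simple, sig_apply]
    have e1 : (cs.wordProd ω * t * (cs.wordProd ω)⁻¹ = cs.simple i) ↔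
        (cs.wordProd ω)⁻¹ * cs.simple i * cs.wordProd ω = t := by
      constructor
      · intro h; rw [← h]; simp [mul_assoc]
      · rintro rfl; simp [mul_assoc]
    simp only [CoxeterSystem.rightInvSeq, List.count_cons, e1, beq_iff_eq, Prod.mk.injEq]
    refine ⟨by simp [mul_assoc], ?_⟩
    push_cast
    ring

theorem act_shift (cs : CoxeterSystem M W) (w t : W) :
    ∃ c : ZMod 2, ∀ e, act cs w (t, e) = (w * t * w⁻¹, e + c) := by
  classical
  obtain ⟨ω, -, rfl⟩ := cs.exists_isReduced w
  exact ⟨_, fun e => act_word cs ω t e⟩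

theorem act_refl (cs : CoxeterSystem M W) {t : W} (ht : cs.IsReflection t) (e : ZMod 2) :
    act cs t (t, e) = (t, e + 1) := by
  classical
  obtain ⟨u, i, rfl⟩ := ht
  obtain ⟨c, hc⟩ := act_shift cs u (cs.simple i)
  have key : ∀ e, act cs u⁻¹ (u * cs.simple i * u⁻¹, e) = (cs.simple i, e - c) := by
    intro e
    rw [map_inv, Equiv.Perm.inv_eq_iff_eq, hc]
    simp
  rw [map_mul, map_mul, Equiv.Perm.mul_apply, Equiv.Perm.mul_apply, key, act_simple, sig_apply]
  simp only [if_true, cs.simple_mul_simple_self, one_mul]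
  rw [hc]
  simp only [Prod.mk.injEq, true_and]
  ring

/-- Strong exchange. -/
theorem mem_ris (cs : CoxeterSystem M W) {t : W} (ht : cs.IsReflection t) (ω : List B)
    (h : cs.length (cs.wordProd ω * t) < cs.length (cs.wordProd ω)) :
    t ∈ cs.rightInvSeq ω := by
  classical
  by_contra hn
  obtain ⟨β, hβ, hb⟩ := cs.exists_isReduced (cs.wordProd ω * t)
  have h1 : act cs (cs.wordProd ω * t) (t, 0) = (cs.wordProd ω * t * (cs.wordProd ω)⁻¹, 1) := by
    rw [map_mul, Equiv.Perm.mul_apply, act_refl cs ht, act_word, List.count_eq_zero_of_not_mem hn]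
    simp
  rw [hb, act_word] at h1
  have h2 := congrArg Prod.snd h1
  simp only at h2
  have h3 : t ∈ cs.rightInvSeq β := by
    by_contra h4
    rw [List.count_eq_zero_of_not_mem h4] at h2
    simp at h2
  have h5 := (cs.isRightInversion_of_mem_rightInvSeq hβ h3).2
  rw [← hb, mul_assoc, ht.mul_self, mul_one] at h5
  omega

theorem exchange (cs : CoxeterSystem M W) (ω : List B) (i : B)
    (h : cs.length (cs.wordProd ω * cs.simple i) < cs.length (cs.wordProd ω)) :
    ∃ j < ω.length, cs.wordProd ω * cs.simple i = cs.wordProd (ω.eraseIdx j) := by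
  have h1 := mem_ris cs (cs.isReflection_simple i) ω h
  obtain ⟨j, hj, hji⟩ := List.mem_iff_getElem.1 h1
  refine ⟨j, by simpa using hj, ?_⟩
  rw [← cs.wordProd_mul_getD_rightInvSeq, List.getD_eq_getElem _ _ hj, hji]

theorem word_mem (cs : CoxeterSystem M W) {K : Set B} {ω : List B} (h : ∀ k ∈ ω, k ∈ K) :
    cs.wordProd ω ∈ par cs K := by
  induction ω with
  | nil => simp [one_mem]
  | cons i ω ih =>
    rw [cs.wordProd_cons]
    exact mul_mem (Subgroup.subset_closure ⟨i, h i (by simp), rfl⟩)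
      (ih fun k hk => h k (by simp [hk]))

theorem exists_reduced_in (cs : CoxeterSystem M W) {K : Set B} {w : W} (hw : w ∈ par cs K) :
    ∃ ω : List B, cs.IsReduced ω ∧ w = cs.wordProd ω ∧ ∀ k ∈ ω, k ∈ K := by
  have step : ∀ (w : W) (k : B), k ∈ K →
      (∃ ω : List B, cs.IsReduced ω ∧ w = cs.wordProd ω ∧ ∀ k ∈ ω, k ∈ K) →
      (∃ ω : List B, cs.IsReduced ω ∧ w * cs.simple k = cs.wordProd ω ∧ ∀ k ∈ ω, k ∈ K) := by
    rintro w k hk ⟨ω, hω, rfl, hK⟩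
    have hω' := hω.eq
    rcases cs.length_mul_simple (cs.wordProd ω) k with h | h
    · have e : cs.wordProd ω * cs.simple k = cs.wordProd (ω ++ [k]) := by
        simp [cs.wordProd_append]
      refine ⟨ω ++ [k], ?_, e, ?_⟩
      · rw [CoxeterSystem.IsReduced, ← e, h, hω']; simp
      · intro l hl
        rcases List.mem_append.1 hl with hl | hl
        · exact hK l hl
        · rw [List.mem_singleton.1 hl]; exact hk
    · obtain ⟨j, hj, e⟩ := exchange cs ω k (by omega)
      refine ⟨ω.eraseIdx j, ?_, e, fun l hl => hK l (List.mem_of_mem_eraseIdx hl)⟩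
      rw [CoxeterSystem.IsReduced, ← e, List.length_eraseIdx_of_lt hj]
      omega
  unfold par at hw
  induction hw using Subgroup.closure_induction_right with
  | one => exact ⟨[], by simp [CoxeterSystem.IsReduced], by simp, by simp⟩
  | mul_right x hx y hy ih =>
    obtain ⟨k, hk, rfl⟩ := hy
    exact step _ k hk ih
  | mul_inv_cancel x hx y hy ih =>
    obtain ⟨k, hk, rfl⟩ := hy
    rw [cs.inv_simple]
    exact step _ k hk ih

theorem length_add (cs : CoxeterSystem M W) {J : Set B} {p : W}
    (hp : ∀ b ∈ par cs J, cs.length p ≤ cs.length (p * b)) {b : W} (hb : b ∈ par cs J) :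
    cs.length (p * b) = cs.length p + cs.length b := by
  obtain ⟨β, hβ, rfl, hK⟩ := exists_reduced_in cs hb
  clear hb
  obtain ⟨α, hα, rfl⟩ := cs.exists_isReduced p
  induction β using List.reverseRecOn with
  | nil => simp
  | append_singleton β k ih =>
    have hβ0 : cs.IsReduced β := by
      have := hβ.take β.length
      simpa using this
    have hKβ : ∀ l ∈ β, l ∈ J := fun l hl => hK l (by simp [hl])
    have hk : k ∈ J := hK k (by simp)
    have ih := ih hβ0 hKβ
    have hβe := hβ.eq
    have hβ0e := hβ0.eq
    have hαe := hα.eq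
    have e : cs.wordProd (β ++ [k]) = cs.wordProd β * cs.simple k := by
      simp [cs.wordProd_append]
    simp only [List.length_append, List.length_singleton] at hβe
    rw [hβe, e, ← mul_assoc]
    rcases cs.length_mul_simple (cs.wordProd α * cs.wordProd β) k with h | h
    · omega
    exfalso
    rw [← cs.wordProd_append] at h
    obtain ⟨j, hj, hje⟩ := exchange cs (α ++ β) k (by omega)
    rcases lt_or_ge j α.length with hl | hl
    · rw [List.eraseIdx_append_of_lt_length hl, cs.wordProd_append, cs.wordProd_append] at hje
      have hs : cs.simple k ∈ par cs J := Subgroup.subset_closure ⟨k, hk, rfl⟩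
      have hm := word_mem cs hKβ
      have := hp (cs.wordProd β * cs.simple k * (cs.wordProd β)⁻¹)
        (mul_mem (mul_mem hm hs) (inv_mem hm))
      rw [← mul_assoc, ← mul_assoc, hje, mul_assoc, mul_inv_cancel, mul_one] at this
      have h2 := cs.length_wordProd_le (α.eraseIdx j)
      rw [List.length_eraseIdx_of_lt hl] at h2
      omega
    · rw [List.eraseIdx_append_of_length_le hl, cs.wordProd_append, cs.wordProd_append,
        mul_assoc, mul_right_inj, ← e] at hje
      have h2 := cs.length_wordProd_le (β.eraseIdx (j - α.length))
      have hj' : j - α.length < β.length := by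
        simp only [List.length_append] at hj; omega
      rw [List.length_eraseIdx_of_lt hj', ← hje, hβe] at h2
      omega

theorem mem_simple_of_length_one (cs : CoxeterSystem M W) {K : Set B} {a : W}
    (ha : a ∈ par cs K) (h : cs.length a = 1) : a ∈ cs.simple '' K := by
  obtain ⟨ω, hω, rfl, hK⟩ := exists_reduced_in cs ha
  rw [hω.eq] at h
  obtain ⟨k, rfl⟩ := List.length_eq_one_iff.1 h
  exact ⟨k, hK k (by simp), by simp⟩

theorem statement_14 (cs : CoxeterSystem M W) (I J : Set B)
    (hI : Finitary cs I) (hJ : Finitary cs J)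
    (pm : W) (hpmin : IsMinRep cs I pm J) :
    IsCore cs I pm J ↔
      cs.simple '' I = (fun v => pm * v * pm⁻¹) '' (cs.simple '' J) := by
  constructor
  · rintro ⟨h1, h2⟩
    have hR : ∀ b ∈ par cs J, cs.length (pm * b) = cs.length pm + cs.length b := fun b hb =>
      length_add cs (fun b hb => hpmin _ ⟨1, one_mem _, b, hb, by simp⟩) hb
    have hL : ∀ a ∈ par cs I, cs.length (a * pm) = cs.length pm + cs.length a := by
      intro a ha
      have := length_add cs (J := I) (p := pm⁻¹) (fun b hb => by
        rw [cs.length_inv, ← cs.length_inv (pm⁻¹ * b)]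
        exact hpmin _ ⟨b⁻¹, inv_mem hb, 1, one_mem _, by simp⟩) (inv_mem ha)
      rw [← mul_inv_rev] at this
      simpa only [cs.length_inv] using this
    apply Set.Subset.antisymm
    · rintro _ ⟨i, hi, rfl⟩
      have hs : cs.simple i ∈ par cs I := Subgroup.subset_closure ⟨i, hi, rfl⟩
      have hm : cs.simple i * pm ∈ rcos cs pm J := by
        rw [← h2, ← h1]; exact ⟨_, hs, rfl⟩
      obtain ⟨b, hb, e⟩ := hm
      have l1 := hL _ hs
      have l2 := hR _ hb
      rw [e, l2, cs.length_simple] at l1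
      refine ⟨b, mem_simple_of_length_one cs hb (by omega), ?_⟩
      simp only
      rw [← e]; simp
    · rintro _ ⟨_, ⟨j, hj, rfl⟩, rfl⟩
      have hs : cs.simple j ∈ par cs J := Subgroup.subset_closure ⟨j, hj, rfl⟩
      have hm : pm * cs.simple j ∈ lcos cs I pm := by
        rw [h1, h2]; exact ⟨_, hs, rfl⟩
      obtain ⟨a, ha, e⟩ := hm
      have l1 := hR _ hs
      have l2 := hL _ ha
      rw [e, l2, cs.length_simple] at l1
      simp only
      rw [e, mul_inv_cancel_right]
      exact mem_simple_of_length_one cs ha (by omega)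
  · intro h
    have hpar : par cs I = (par cs J).map (MulAut.conj pm).toMonoidHom := by
      unfold par
      rw [MonoidHom.map_closure, h]
      rfl
    have f1 : ∀ b ∈ par cs J, pm * b * pm⁻¹ ∈ par cs I := by
      intro b hb
      rw [hpar]; exact ⟨b, hb, rfl⟩
    have f2 : ∀ a ∈ par cs I, pm⁻¹ * a * pm ∈ par cs J := by
      intro a ha
      rw [hpar] at ha
      obtain ⟨b, hb, rfl⟩ := ha
      simpa [mul_assoc] using hb
    constructor
    · apply Set.Subset.antisymm
      · rintro _ ⟨a, ha, rfl⟩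
        exact ⟨a, ha, 1, one_mem _, by simp⟩
      · rintro _ ⟨a, ha, b, hb, rfl⟩
        exact ⟨a * (pm * b * pm⁻¹), mul_mem ha (f1 b hb), by simp [mul_assoc]⟩
    · apply Set.Subset.antisymm
      · rintro _ ⟨a, ha, b, hb, rfl⟩
        exact ⟨(pm⁻¹ * a * pm) * b, mul_mem (f2 a ha) hb, by simp [mul_assoc]⟩
      · rintro _ ⟨b, hb, rfl⟩
        exact ⟨1, one_mem _, b, hb, by simp⟩

end CoxeterAtoms
end
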